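/- Let k be a function field over F_q, n ≥ 2, A_1, ..., A_J representatives of the degree-0 divisor classes, A_0 a divisor of degree 1, and λ(A, n) = q^{n·l(A,1)} - 1. Then for every integer 0 ≤ i ≤ 2g - 2 (g the genus of k): Σ_{j=1}^{J} λ(A_j + i·A_0, n) ≤ C · a(i) · q^{(n-1)i/2}, where a(i) is the number of effective divisors of degree i and C depends only on n and q. -/

import Mathlib

open scoped BigOperators

/-- The degree of a divisor (a finitely supported `ℤ`-valued function on places),
where `dg v` is the degree of the place `v`. -/
noncomputable def divDeg {P : Type} (dg : P → ℕ) (D : P →₀ ℤ) : ℤ :=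
  D.sum fun v n => n * (dg v : ℤ)

/-- Abstract data of a function field over a finite constant field `F_q`:
a set of places with degrees, the subgroup of principal divisors, the genus `g`,
a canonical divisor `W`, and the Riemann–Roch dimension `ell D = l(D)`, subject to
the defining axioms (degree of principal divisors is `0`, invariance of `l` under
linear equivalence, the Riemann–Roch theorem, and the count of effective divisors
linearly equivalent to a given divisor in terms of `q ^ l(D)`). -/
structure CurveData where
  Place : Type
  dg : Place → ℕ
  dg_pos : ∀ v, 0 < dg v
  q : ℕ
  q_pp : IsPrimePow q
  prin : AddSubgroup (Place →₀ ℤ)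
  deg_prin : ∀ D ∈ prin, divDeg dg D = 0
  g : ℕ
  W : Place →₀ ℤ
  degW : divDeg dg W = 2 * (g : ℤ) - 2
  ell : (Place →₀ ℤ) → ℕ
  ell_equiv : ∀ D E : Place →₀ ℤ, D - E ∈ prin → ell D = ell E
  ell_neg : ∀ D : Place →₀ ℤ, divDeg dg D < 0 → ell D = 0
  riemannRoch : ∀ D : Place →₀ ℤ, (ell D : ℤ) = divDeg dg D + 1 - g + ell (W - D)
  count : ∀ D : Place →₀ ℤ,
    (q - 1) * Nat.card {E : Place →₀ ℤ // (∀ v, 0 ≤ E v) ∧ E - D ∈ prin} = q ^ ell D - 1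
  finEff : ∀ l : ℤ, {D : Place →₀ ℤ | (∀ v, 0 ≤ D v) ∧ divDeg dg D = l}.Finite

namespace CurveData

variable (C : CurveData)

/-- `a l` : the number of effective divisors of degree `l`. -/
noncomputable def a (l : ℤ) : ℕ :=
  Nat.card {D : C.Place →₀ ℤ // (∀ v, 0 ≤ D v) ∧ divDeg C.dg D = l}

/-- `J` : the number of divisor classes of degree `0` (the class number). -/
noncomputable def J : ℕ :=
  Nat.card (Quot fun D E : {D : C.Place →₀ ℤ // divDeg C.dg D = 0} =>
    (D : C.Place →₀ ℤ) - (E : C.Place →₀ ℤ) ∈ C.prin)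

/-- The zeta function `ζ_k(s) = Σ_{l ≥ 0} a(l) q^{-sl}`. -/
noncomputable def zeta (s : ℝ) : ℝ :=
  ∑' l : ℕ, (C.a l : ℝ) * (C.q : ℝ) ^ (-(s * (l : ℝ)))

end CurveData

namespace CurveAux

lemma divDeg_add {P : Type} (dg : P → ℕ) (D E : P →₀ ℤ) :
    divDeg dg (D + E) = divDeg dg D + divDeg dg E := by
  unfold divDeg
  exact Finsupp.sum_add_index' (by simp) (by intros; ring)

lemma divDeg_zero {P : Type} (dg : P → ℕ) : divDeg dg (0 : P →₀ ℤ) = 0 := by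
  simp [divDeg]

lemma divDeg_neg {P : Type} (dg : P → ℕ) (D : P →₀ ℤ) :
    divDeg dg (-D) = - divDeg dg D := by
  have h := divDeg_add dg D (-D)
  rw [add_neg_cancel, divDeg_zero] at h
  linarith

lemma divDeg_sub {P : Type} (dg : P → ℕ) (D E : P →₀ ℤ) :
    divDeg dg (D - E) = divDeg dg D - divDeg dg E := by
  rw [sub_eq_add_neg, divDeg_add, divDeg_neg]; ring

lemma divDeg_single {P : Type} (dg : P → ℕ) (v : P) (n : ℤ) :
    divDeg dg (Finsupp.single v n) = n * dg v := by
  simp [divDeg, Finsupp.sum_single_index]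

lemma divDeg_nsmul {P : Type} (dg : P → ℕ) (n : ℕ) (D : P →₀ ℤ) :
    divDeg dg ((n : ℤ) • D) = n * divDeg dg D := by
  induction n with
  | zero => simp [divDeg_zero]
  | succ k ih =>
    have : ((k + 1 : ℕ) : ℤ) • D = (k : ℤ) • D + D := by
      push_cast; rw [add_smul, one_smul]
    rw [this, divDeg_add, ih]; push_cast; ring

variable (C : CurveData)

/-- effective divisors linearly equivalent to `D` -/
def eff (D : C.Place →₀ ℤ) : Set (C.Place →₀ ℤ) :=
  {E | (∀ v, 0 ≤ E v) ∧ E - D ∈ C.prin}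

lemma deg_eff {D E : C.Place →₀ ℤ} (h : E ∈ eff C D) : divDeg C.dg E = divDeg C.dg D := by
  have := C.deg_prin _ h.2
  rw [divDeg_sub] at this
  linarith

lemma eff_finite (D : C.Place →₀ ℤ) : (eff C D).Finite :=
  (C.finEff (divDeg C.dg D)).subset fun _ h => ⟨h.1, deg_eff C h⟩

lemma two_le_q : 2 ≤ C.q := C.q_pp.two_le

lemma count' (D : C.Place →₀ ℤ) :
    ((C.q : ℤ) - 1) * ((eff C D).ncard : ℤ) = (C.q : ℤ) ^ C.ell D - 1 := by
  have h := C.count D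
  have h2 := two_le_q C
  have h3 : 1 ≤ C.q ^ C.ell D := Nat.one_le_pow _ _ (by omega)
  have h4 : ((eff C D).ncard) = Nat.card {E : C.Place →₀ ℤ // (∀ v, 0 ≤ E v) ∧ E - D ∈ C.prin} := rfl
  rw [h4]
  zify [h3, (by omega : 1 ≤ C.q)] at h
  exact h

lemma ell_le_iff (D E : C.Place →₀ ℤ) :
    (eff C D).ncard ≤ (eff C E).ncard ↔ C.ell D ≤ C.ell E := by
  have h1 := count' C D
  have h2 := count' C E
  have hq := two_le_q C
  have hq' : (0 : ℤ) < (C.q : ℤ) - 1 := by have : (2 : ℤ) ≤ C.q := by exact_mod_cast hq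
                                           linarith
  rw [show C.ell D ≤ C.ell E ↔ C.q ^ C.ell D ≤ C.q ^ C.ell E from
    (Nat.pow_le_pow_iff_right (by omega)).symm]
  zify
  constructor
  · intro h
    have := mul_le_mul_of_nonneg_left h hq'.le
    linarith
  · intro h
    have : ((C.q : ℤ) - 1) * ((eff C D).ncard : ℤ) ≤ ((C.q : ℤ) - 1) * ((eff C E).ncard : ℤ) := by
      linarith
    exact le_of_mul_le_mul_left this hq'

lemma ell_pos_iff (D : C.Place →₀ ℤ) : 1 ≤ C.ell D ↔ (eff C D).Nonempty := by
  have h1 := count' C D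
  have hq := two_le_q C
  have hq' : (2 : ℤ) ≤ C.q := by exact_mod_cast hq
  rw [← Set.ncard_pos (eff_finite C D)]
  constructor
  · intro h
    by_contra h0
    have h0 : (eff C D).ncard = 0 := by omega
    rw [h0] at h1
    have : (C.q : ℤ) ^ 1 ≤ (C.q : ℤ) ^ C.ell D := pow_le_pow_right₀ (by linarith) h
    simp at h1
    linarith
  · intro h
    by_contra h0
    have h0 : C.ell D = 0 := by omega
    rw [h0, pow_zero, sub_self] at h1
    have : (0:ℤ) < ((eff C D).ncard : ℤ) := by exact_mod_cast h
    rcases mul_eq_zero.1 h1 with h1 | h1 <;> linarith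

/-- adding an effective divisor -/
lemma ell_mono (D F : C.Place →₀ ℤ) (hF : ∀ v, 0 ≤ F v) : C.ell D ≤ C.ell (D + F) := by
  rw [← ell_le_iff]
  refine Set.ncard_le_ncard_of_injOn (fun E => E + F) ?_ ?_ (eff_finite C _)
  · intro E hE
    refine ⟨fun v => ?_, ?_⟩
    · have := hE.1 v; have := hF v; simp; linarith
    · have := hE.2
      simpa using this
  · intro a _ b _ h
    simpa using h

lemma eff_deg_nonneg {F : C.Place →₀ ℤ} (hF : ∀ v, 0 ≤ F v) : 0 ≤ divDeg C.dg F := by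
  unfold divDeg
  exact Finset.sum_nonneg fun v _ => mul_nonneg (hF v) (by positivity)

lemma eff_deg_zero {F : C.Place →₀ ℤ} (hF : ∀ v, 0 ≤ F v) (h : divDeg C.dg F = 0) : F = 0 := by
  unfold divDeg Finsupp.sum at h
  rw [Finset.sum_eq_zero_iff_of_nonneg (fun v _ => mul_nonneg (hF v) (by positivity))] at h
  ext v
  by_contra hv
  have h1 := h v (by simpa using hv)
  have h2 := C.dg_pos v
  rcases mul_eq_zero.1 h1 with h1 | h1
  · exact hv (by simpa using h1)
  · have : C.dg v = 0 := by exact_mod_cast h1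
    omega

lemma ell_le_one {D : C.Place →₀ ℤ} (h : divDeg C.dg D = 0) : C.ell D ≤ 1 := by
  have h1 := count' C D
  have hq : (2 : ℤ) ≤ C.q := by exact_mod_cast two_le_q C
  have h2 : (eff C D).ncard ≤ 1 := by
    rw [Set.ncard_le_one (eff_finite C D)]
    intro a ha b hb
    rw [eff_deg_zero C ha.1 ((deg_eff C ha).trans h), eff_deg_zero C hb.1 ((deg_eff C hb).trans h)]
  have h2 : ((eff C D).ncard : ℤ) ≤ 1 := by exact_mod_cast h2
  by_contra h3
  have : (C.q : ℤ) ^ 2 ≤ (C.q : ℤ) ^ C.ell D := pow_le_pow_right₀ (by linarith) (by omega)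
  nlinarith

lemma ell_zero : C.ell 0 = 1 := by
  apply le_antisymm (ell_le_one C (divDeg_zero _))
  rw [ell_pos_iff]
  exact ⟨0, by simp, by simp [C.prin.zero_mem]⟩

lemma eff_sub (D : C.Place →₀ ℤ) (v : C.Place) (i : ℕ) :
    {E ∈ eff C D | (i : ℤ) ≤ E v}.ncard = (eff C (D - Finsupp.single v (i : ℤ))).ncard := by
  classical
  symm
  rw [← Set.ncard_image_of_injective (eff C (D - Finsupp.single v (i : ℤ)))
    (add_left_injective (Finsupp.single v (i : ℤ)))]
  congr 1
  ext E
  simp only [Set.mem_image, Set.mem_ofPred_eq, eff]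
  constructor
  · rintro ⟨E', ⟨h1, h2⟩, rfl⟩
    refine ⟨⟨fun w => ?_, ?_⟩, ?_⟩
    · have := h1 w
      simp only [Finsupp.add_apply, Finsupp.single_apply]
      split_ifs <;> omega
    · convert h2 using 1; abel
    · have := h1 v
      simp only [Finsupp.add_apply, Finsupp.single_apply, if_true]; omega
  · rintro ⟨⟨h1, h2⟩, h3⟩
    refine ⟨E - Finsupp.single v (i : ℤ), ⟨fun w => ?_, ?_⟩, by abel⟩
    · have := h1 w
      simp only [Finsupp.sub_apply, Finsupp.single_apply]
      split_ifs with h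
      · subst h; omega
      · omega
    · convert h2 using 1; abel

/-- double counting the degree of all members of a linear system -/
lemma double_count (D : C.Place →₀ ℤ) : ∃ (T0 : Finset C.Place) (I0 : ℕ),
    ∀ T, T0 ⊆ T → ∀ I, I0 ≤ I →
      ((eff C D).ncard : ℤ) * divDeg C.dg D =
        ∑ v ∈ T, ∑ i ∈ Finset.Icc 1 I,
          (C.dg v : ℤ) * ((eff C (D - Finsupp.single v (i : ℤ))).ncard : ℤ) := by
  classical
  set X := (eff_finite C D).toFinset with hX
  have hmem : ∀ E, E ∈ X ↔ E ∈ eff C D := by simp [hX]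
  refine ⟨X.biUnion fun E => E.support,
    X.sup fun E => E.support.sup fun v => (E v).toNat, ?_⟩
  intro T hT I hI
  have hcard : (eff C D).ncard = X.card := Set.ncard_eq_toFinset_card _ (eff_finite C D)
  have h1 : ((eff C D).ncard : ℤ) * divDeg C.dg D = ∑ E ∈ X, divDeg C.dg E := by
    rw [Finset.sum_congr rfl (fun E hE => deg_eff C ((hmem E).1 hE)), Finset.sum_const, hcard]
    simp
  have h2 : ∀ E ∈ X, divDeg C.dg E = ∑ v ∈ T, ∑ i ∈ Finset.Icc 1 I,
      (C.dg v : ℤ) * (if (i : ℤ) ≤ E v then 1 else 0) := by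
    intro E hE
    have hs : E.support ⊆ T :=
      (Finset.subset_biUnion_of_mem (fun E : C.Place →₀ ℤ => E.support) hE).trans hT
    unfold divDeg
    rw [Finsupp.sum_of_support_subset E hs _ (by simp)]
    apply Finset.sum_congr rfl
    intro v _
    have hv0 := ((hmem E).1 hE).1 v
    have hvI : (E v).toNat ≤ I := by
      by_cases hv : v ∈ E.support
      · calc (E v).toNat ≤ E.support.sup fun v => (E v).toNat :=
              Finset.le_sup (f := fun v => (E v).toNat) hv
          _ ≤ _ := Finset.le_sup (f := fun E : C.Place →₀ ℤ =>
              E.support.sup fun v => (E v).toNat) hE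
          _ ≤ I := hI
      · rw [Finsupp.notMem_support_iff] at hv
        simp [hv]
    rw [← Finset.mul_sum, mul_comm]
    congr 1
    rw [Finset.sum_boole]
    have : (Finset.Icc 1 I).filter (fun i : ℕ => (i : ℤ) ≤ E v) = Finset.Icc 1 (E v).toNat := by
      ext i; simp only [Finset.mem_filter, Finset.mem_Icc]; omega
    rw [this]
    simp; omega
  rw [h1, Finset.sum_congr rfl h2, Finset.sum_comm]
  apply Finset.sum_congr rfl
  intro v _
  rw [Finset.sum_comm]
  apply Finset.sum_congr rfl
  intro i _
  rw [← Finset.mul_sum, Finset.sum_boole, ← eff_sub]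
  congr 2
  rw [← Set.ncard_coe_finset]
  congr 1
  ext E
  simp [hmem]

/-- the key numerical inequality -/
lemma key_num (q A r e L B : ℕ) (hq : 1 ≤ q) (hAr : A ≤ r) (he : 1 ≤ e) (hL : L + 2 ≤ r + e)
    (hB : A + e ≤ B + 1) :
    ((q : ℤ) ^ A - 1) * ((q : ℤ) ^ (L + 1) - 1) ≤ ((q : ℤ) ^ B - 1) * ((q : ℤ) ^ r - 1) := by
  obtain ⟨s, rfl⟩ : ∃ s, e = s + 1 := ⟨e - 1, by omega⟩
  have hq' : (1 : ℤ) ≤ q := by exact_mod_cast hq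
  have h1 : (q : ℤ) ^ (L + 1) ≤ (q : ℤ) ^ (r + s) := pow_le_pow_right₀ hq' (by omega)
  have h2 : (q : ℤ) ^ (A + s) ≤ (q : ℤ) ^ B := pow_le_pow_right₀ hq' (by omega)
  have h3 : (q : ℤ) ^ A ≤ (q : ℤ) ^ r := pow_le_pow_right₀ hq' hAr
  have h4 : (1 : ℤ) ≤ (q : ℤ) ^ A := one_le_pow₀ hq'
  have h5 : (1 : ℤ) ≤ (q : ℤ) ^ s := one_le_pow₀ hq'
  calc ((q : ℤ) ^ A - 1) * ((q : ℤ) ^ (L + 1) - 1)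
      ≤ ((q : ℤ) ^ A - 1) * ((q : ℤ) ^ (r + s) - 1) :=
        mul_le_mul_of_nonneg_left (by linarith) (by linarith)
    _ ≤ ((q : ℤ) ^ (A + s) - 1) * ((q : ℤ) ^ r - 1) := by
        rw [pow_add, pow_add]
        nlinarith [mul_nonneg (sub_nonneg.2 h5) (sub_nonneg.2 h3)]
    _ ≤ _ := mul_le_mul_of_nonneg_right (by linarith) (by linarith)

/-- one half of the inductive step -/
lemma half_step (D E : C.Place →₀ ℤ) (hD : 1 ≤ C.ell D) (hE : 1 ≤ C.ell E)
    (hbad : C.ell (D + E) + 2 ≤ C.ell D + C.ell E)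
    (ih : ∀ (v : C.Place) (i : ℕ), 1 ≤ i → 1 ≤ C.ell (D - Finsupp.single v (i : ℤ)) →
      C.ell (D - Finsupp.single v (i : ℤ)) + C.ell E ≤
        C.ell (D + E - Finsupp.single v (i : ℤ)) + 1) :
    ((C.q : ℤ) * ((eff C (D + E)).ncard : ℤ) + 1) * divDeg C.dg D ≤
      ((eff C (D + E)).ncard : ℤ) * divDeg C.dg (D + E) := by
  classical
  obtain ⟨T1, I1, h1⟩ := double_count C D
  obtain ⟨T2, I2, h2⟩ := double_count C (D + E)
  have h1 := h1 (T1 ∪ T2) Finset.subset_union_left (max I1 I2) (le_max_left _ _)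
  have h2 := h2 (T1 ∪ T2) Finset.subset_union_right (max I1 I2) (le_max_right _ _)
  have hq : (2 : ℤ) ≤ C.q := by exact_mod_cast two_le_q C
  have hNpos : (0 : ℤ) < (eff C D).ncard := by
    have := (Set.ncard_pos (eff_finite C D)).2 ((ell_pos_iff C D).1 hD)
    exact_mod_cast this
  have key : ∀ (v : C.Place) (i : ℕ), 1 ≤ i →
      ((C.q : ℤ) * ((eff C (D + E)).ncard : ℤ) + 1) *
        ((eff C (D - Finsupp.single v (i : ℤ))).ncard : ℤ) ≤
      ((eff C D).ncard : ℤ) * ((eff C (D + E - Finsupp.single v (i : ℤ))).ncard : ℤ) := by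
    intro v i hi
    by_cases hA : 1 ≤ C.ell (D - Finsupp.single v (i : ℤ))
    · have hB := ih v i hi hA
      have hAr : C.ell (D - Finsupp.single v (i : ℤ)) ≤ C.ell D := by
        have := ell_mono C (D - Finsupp.single v (i : ℤ)) (Finsupp.single v (i : ℤ))
          (by intro w; simp only [Finsupp.single_apply]; split_ifs <;> omega)
        rwa [sub_add_cancel] at this
      have hk := key_num C.q _ _ _ _ _ (by have := two_le_q C; omega) hAr hE hbad hB
      have c1 := count' C (D - Finsupp.single v (i : ℤ))
      have c2 := count' C (D + E - Finsupp.single v (i : ℤ))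
      have c3 := count' C D
      have c4 := count' C (D + E)
      rw [← c1, ← c2, ← c3, pow_succ] at hk
      have c5 : (C.q : ℤ) ^ C.ell (D + E) = ((C.q : ℤ) - 1) * ((eff C (D + E)).ncard : ℤ) + 1 := by
        linarith
      rw [c5] at hk
      have hpos : (0 : ℤ) < ((C.q : ℤ) - 1) * ((C.q : ℤ) - 1) := by
        apply mul_pos <;> linarith
      refine le_of_mul_le_mul_left ?_ hpos
      linarith
    · have : (eff C (D - Finsupp.single v (i : ℤ))).ncard = 0 := by
        rw [ell_pos_iff, Set.not_nonempty_iff_eq_empty] at hA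
        rw [hA]; simp
      rw [this]
      simp only [Nat.cast_zero, mul_zero]
      positivity
  refine le_of_mul_le_mul_left ?_ hNpos
  calc ((eff C D).ncard : ℤ) * (((C.q : ℤ) * ((eff C (D + E)).ncard : ℤ) + 1) * divDeg C.dg D)
      = ((C.q : ℤ) * ((eff C (D + E)).ncard : ℤ) + 1) *
          (((eff C D).ncard : ℤ) * divDeg C.dg D) := by ring
    _ ≤ ((eff C D).ncard : ℤ) * (((eff C (D + E)).ncard : ℤ) * divDeg C.dg (D + E)) := by
        rw [h1, h2]
        simp only [Finset.mul_sum]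
        apply Finset.sum_le_sum
        intro v _
        apply Finset.sum_le_sum
        intro i hi
        have := mul_le_mul_of_nonneg_left (key v i (Finset.mem_Icc.1 hi).1)
          (by positivity : (0 : ℤ) ≤ C.dg v)
        linarith

lemma hopf (m : ℕ) : ∀ D E : C.Place →₀ ℤ, 1 ≤ C.ell D → 1 ≤ C.ell E →
    divDeg C.dg (D + E) = m → C.ell D + C.ell E ≤ C.ell (D + E) + 1 := by
  induction m using Nat.strong_induction_on with
  | _ m IH =>
  intro D E hD hE hm
  have degnn : ∀ D : C.Place →₀ ℤ, 1 ≤ C.ell D → 0 ≤ divDeg C.dg D := by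
    intro D hD
    by_contra h
    have := C.ell_neg D (by linarith)
    omega
  by_contra hbad
  have ih : ∀ D' E' : C.Place →₀ ℤ, 1 ≤ C.ell E' → D' + E' = D + E →
      ∀ (v : C.Place) (i : ℕ), 1 ≤ i → 1 ≤ C.ell (D' - Finsupp.single v (i : ℤ)) →
      C.ell (D' - Finsupp.single v (i : ℤ)) + C.ell E' ≤
        C.ell (D' + E' - Finsupp.single v (i : ℤ)) + 1 := by
    intro D' E' hE' hs v i hi hA
    have e1 : D' + E' - Finsupp.single v (i : ℤ) = D' - Finsupp.single v (i : ℤ) + E' := by abel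
    have d1 := degnn _ hA
    have d2 := degnn _ hE'
    have d3 : divDeg C.dg (D' - Finsupp.single v (i : ℤ) + E') = m - i * C.dg v := by
      rw [← e1, divDeg_sub, divDeg_single, hs, hm]
    have d4 : 0 < i * C.dg v := Nat.mul_pos hi (C.dg_pos v)
    have d5 := divDeg_add C.dg (D' - Finsupp.single v (i : ℤ)) E'
    rw [e1]
    have d6 : ((i * C.dg v : ℕ) : ℤ) = (i : ℤ) * C.dg v := by push_cast; ring
    refine IH (m - i * C.dg v) (by omega) _ _ hA hE' ?_
    rw [d3]; omega
  have s1 := half_step C D E hD hE (by omega) (ih D E hE rfl)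
  have s2 := half_step C E D hE hD (by rw [add_comm E D]; omega) (ih E D hD (add_comm _ _))
  rw [add_comm E D] at s2
  have hadd := divDeg_add C.dg D E
  have hq : (2 : ℤ) ≤ C.q := by exact_mod_cast two_le_q C
  have d1 := degnn _ hD
  have d2 := degnn _ hE
  have hN : (0 : ℤ) ≤ (eff C (D + E)).ncard := by positivity
  by_cases h0 : divDeg C.dg (D + E) = 0
  · have l1 := ell_le_one C (D := D) (by linarith)
    obtain ⟨F, hF, hF2⟩ := (ell_pos_iff C E).1 hE
    have l2 : C.ell D ≤ C.ell (D + E) := by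
      rw [← C.ell_equiv (D + F) (D + E) (by simpa using hF2)]
      exact ell_mono C D F hF
    have l3 := ell_le_one C (D := E) (by linarith)
    omega
  · have hpos : 0 < divDeg C.dg (D + E) := lt_of_le_of_ne (by linarith) (Ne.symm h0)
    set N : ℤ := ((eff C (D + E)).ncard : ℤ)
    have : ((C.q : ℤ) * N + 1) * divDeg C.dg (D + E) ≤ 2 * N * divDeg C.dg (D + E) := by
      rw [hadd] at *; linarith
    have := le_of_mul_le_mul_right this hpos
    nlinarith

lemma clifford (D : C.Place →₀ ℤ) (i : ℕ) (hi : (i : ℤ) ≤ 2 * (C.g : ℤ) - 2)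
    (hD : divDeg C.dg D = i) : 2 * C.ell D ≤ i + 2 := by
  have rr := C.riemannRoch D
  have rr0 := C.riemannRoch 0
  rw [divDeg_zero, ell_zero, sub_zero] at rr0
  by_cases h1 : 1 ≤ C.ell D
  · by_cases h2 : 1 ≤ C.ell (C.W - D)
    · have := hopf C (2 * C.g - 2) D (C.W - D) h1 h2 (by
        rw [add_sub_cancel, C.degW]; omega)
      rw [add_sub_cancel] at this
      omega
    · omega
  · omega

end CurveAux

/-- Let `k` be a function field over `F_q`, `n ≥ 2`, `A_1, ..., A_J`
representatives of the degree-0 divisor classes, `A_0` a divisor of degree `1`, and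
`λ(A, n) = q^(n·l(A,1)) - 1`. Then for every integer `0 ≤ i ≤ 2g - 2` (`g` the genus),
`Σ_j λ(A_j + iA_0, n) ≤ c · a(i) · q^((n-1)i/2)`, where `a(i)` is the number of
effective divisors of degree `i` and `c` depends only on `n` and `q`. -/
theorem stmt_14 (n q : ℕ) (hn : 2 ≤ n) :
    ∃ c : ℝ, 0 < c ∧
      ∀ C : CurveData, C.q = q →
        ∀ (Jn : ℕ) (A : Fin Jn → (C.Place →₀ ℤ)),
          (∀ j, divDeg C.dg (A j) = 0) →
          (∀ D : C.Place →₀ ℤ, divDeg C.dg D = 0 → ∃ j, D - A j ∈ C.prin) →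
          (∀ j j', A j - A j' ∈ C.prin → j = j') →
          ∀ A0 : C.Place →₀ ℤ, divDeg C.dg A0 = 1 →
            ∀ i : ℕ, (i : ℤ) ≤ 2 * (C.g : ℤ) - 2 →
              ∑ j, ((q : ℝ) ^ (n * C.ell (A j + (i : ℤ) • A0)) - 1) ≤
                c * (C.a i : ℝ) * (q : ℝ) ^ (((n : ℝ) - 1) * (i : ℝ) / 2) := by
  classical
  refine ⟨(n : ℝ) * (q : ℝ) ^ (n - 1) * q + 1, by positivity, ?_⟩
  intro C hCq Jn A hA0 _ hAinj A0 hdA0 i hi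
  have hq2 : 2 ≤ q := hCq ▸ CurveAux.two_le_q C
  have hqR : (2 : ℝ) ≤ q := by exact_mod_cast hq2
  have hq1 : (1 : ℝ) ≤ q := by linarith
  have hq0 : (0 : ℝ) < q := by linarith
  have hdeg : ∀ j, divDeg C.dg (A j + (i : ℤ) • A0) = i := by
    intro j
    rw [CurveAux.divDeg_add, CurveAux.divDeg_nsmul, hA0, hdA0]; ring
  set Y : ℝ := (q : ℝ) ^ (((n : ℝ) - 1) * (i : ℝ) / 2) with hY
  have hYpos : 0 < Y := Real.rpow_pos_of_pos hq0 _
  -- termwise bound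
  have hterm : ∀ j, (q : ℝ) ^ (n * C.ell (A j + (i : ℤ) • A0)) - 1 ≤
      (n : ℝ) * (q : ℝ) ^ (n - 1) * q * Y *
        ((CurveAux.eff C (A j + (i : ℤ) • A0)).ncard : ℝ) := by
    intro j
    have hcl := CurveAux.clifford C _ i hi (hdeg j)
    have hct := CurveAux.count' C (A j + (i : ℤ) • A0)
    set l := C.ell (A j + (i : ℤ) • A0)
    set N := (CurveAux.eff C (A j + (i : ℤ) • A0)).ncard
    rw [hCq] at hct
    have hct' : ((q : ℝ) - 1) * (N : ℝ) = (q : ℝ) ^ l - 1 := by exact_mod_cast hct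
    have hl1 : (1 : ℝ) ≤ (q : ℝ) ^ l := one_le_pow₀ hq1
    have hpow : ((q : ℝ) ^ l) ^ (n - 1) ≤ (q : ℝ) ^ (n - 1) * Y := by
      rw [← pow_mul, ← Real.rpow_natCast, ← Real.rpow_natCast, hY, ← Real.rpow_add hq0]
      apply Real.rpow_le_rpow_of_exponent_le hq1
      have hcl' : 2 * (l : ℝ) ≤ i + 2 := by exact_mod_cast hcl
      have hn1 : ((n - 1 : ℕ) : ℝ) = (n : ℝ) - 1 := by
        rw [Nat.cast_sub (by omega)]; simp
      rw [Nat.cast_mul, hn1]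
      have hn0 : (0 : ℝ) ≤ (n : ℝ) - 1 := by
        have : (2 : ℝ) ≤ n := by exact_mod_cast hn
        linarith
      nlinarith
    have hgeom : ((q : ℝ) ^ l) ^ n - 1 ≤ n * ((q : ℝ) ^ l) ^ (n - 1) * ((q : ℝ) ^ l - 1) := by
      rw [← geom_sum_mul]
      apply mul_le_mul_of_nonneg_right _ (by linarith)
      calc ∑ k ∈ Finset.range n, ((q : ℝ) ^ l) ^ k
          ≤ ∑ k ∈ Finset.range n, ((q : ℝ) ^ l) ^ (n - 1) := by
            apply Finset.sum_le_sum
            intro k hk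
            have := Finset.mem_range.1 hk
            exact pow_le_pow_right₀ hl1 (by omega)
        _ = _ := by simp
    have hNN : (0 : ℝ) ≤ N := by positivity
    calc (q : ℝ) ^ (n * l) - 1 = ((q : ℝ) ^ l) ^ n - 1 := by rw [← pow_mul, mul_comm]
      _ ≤ n * ((q : ℝ) ^ l) ^ (n - 1) * ((q : ℝ) ^ l - 1) := hgeom
      _ ≤ n * ((q : ℝ) ^ (n - 1) * Y) * (q * N) := by
          apply mul_le_mul
          · exact mul_le_mul_of_nonneg_left hpow (by positivity)
          · rw [← hct']; nlinarith
          · linarith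
          · positivity
      _ = _ := by ring
  -- counting
  have hsum : ∑ j, (CurveAux.eff C (A j + (i : ℤ) • A0)).ncard ≤ C.a i := by
    let X : Fin Jn → Finset (C.Place →₀ ℤ) :=
      fun j => (CurveAux.eff_finite C (A j + (i : ℤ) • A0)).toFinset
    have hX : ∀ j, (CurveAux.eff C (A j + (i : ℤ) • A0)).ncard = (X j).card :=
      fun j => Set.ncard_eq_toFinset_card _ _
    simp only [hX]
    rw [← Finset.card_biUnion]
    · have hfin := C.finEff (i : ℤ)
      have ha : C.a i = {D : C.Place →₀ ℤ | (∀ v, 0 ≤ D v) ∧ divDeg C.dg D = (i : ℤ)}.ncard := rfl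
      rw [ha, ← Set.ncard_coe_finset]
      apply Set.ncard_le_ncard _ hfin
      intro E hE
      simp only [Finset.coe_biUnion, Set.mem_iUnion, X, Set.Finite.coe_toFinset] at hE
      obtain ⟨j, _, hj⟩ := hE
      exact ⟨hj.1, (CurveAux.deg_eff C hj).trans (hdeg j)⟩
    · intro j _ j' _ hne
      rw [Function.onFun, Finset.disjoint_left]
      intro E h1 h2
      simp only [X, Set.Finite.mem_toFinset] at h1 h2
      apply hne
      apply hAinj
      have := C.prin.sub_mem h2.2 h1.2
      convert this using 1
      abel
  have hsum' : ∑ j, ((CurveAux.eff C (A j + (i : ℤ) • A0)).ncard : ℝ) ≤ (C.a i : ℝ) := by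
    exact_mod_cast hsum
  calc ∑ j, ((q : ℝ) ^ (n * C.ell (A j + (i : ℤ) • A0)) - 1)
      ≤ ∑ j, (n : ℝ) * (q : ℝ) ^ (n - 1) * q * Y *
        ((CurveAux.eff C (A j + (i : ℤ) • A0)).ncard : ℝ) :=
        Finset.sum_le_sum fun j _ => hterm j
    _ = (n : ℝ) * (q : ℝ) ^ (n - 1) * q * Y *
        ∑ j, ((CurveAux.eff C (A j + (i : ℤ) • A0)).ncard : ℝ) := by rw [Finset.mul_sum]
    _ ≤ (n : ℝ) * (q : ℝ) ^ (n - 1) * q * Y * (C.a i : ℝ) :=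
        mul_le_mul_of_nonneg_left hsum' (by positivity)
    _ ≤ _ := by
        have : 0 ≤ (C.a i : ℝ) * Y := by positivity
        nlinarith
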